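/- Let 1 ≤ k ≤ n−1, let H1 be the (k+1)-uniform hypergraph consisting of all (k+1)-element subsets of X containing the variable x1, and let φℓ = θ(H1). Then φℓ is ucp-irredundant and ucp-equivalent to Ψ_{n,k}. -/

import Mathlib

/-- A literal on variables `x_1, …, x_n`: a variable together with a polarity
(`true` = positive literal, `false` = negative literal). -/
abbrev Lit (n : ℕ) := Fin n × Bool

/-- A clause is a finite set of literals. -/
abbrev Clause (n : ℕ) := Finset (Lit n)

/-- A CNF formula is a finite set of clauses. -/
abbrev CnfFormula (n : ℕ) := Finset (Clause n)

/-- Negation of a literal. -/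
def negLit {n : ℕ} (l : Lit n) : Lit n := (l.1, !l.2)

/-- A clause is well-formed if its literals are on pairwise distinct variables. -/
def Clause.Wf {n : ℕ} (C : Clause n) : Prop :=
  ∀ l ∈ C, ∀ l' ∈ C, l.1 = l'.1 → l = l'

/-- A partial assignment: a set of literals containing no complementary pair. -/
def IsPartialAssignment {n : ℕ} (α : Finset (Lit n)) : Prop :=
  ∀ l ∈ α, negLit l ∉ α

/-- The set of unit clauses corresponding to a set of literals. -/
def unitClauses {n : ℕ} (α : Finset (Lit n)) : CnfFormula n :=
  α.image (fun l => {l})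

/-- `UcpDeriv φ l` says that `l` lies in the least set `U` of literals closed under
the rule: if `C ∈ φ`, `l ∈ C`, and the negation of every literal of `C \ {l}`
lies in `U`, then `l ∈ U`. -/
inductive UcpDeriv {n : ℕ} (φ : CnfFormula n) : Lit n → Prop
  | step (C : Clause n) (hC : C ∈ φ) (l : Lit n) (hl : l ∈ C)
      (h : ∀ l' ∈ C.erase l, UcpDeriv φ (negLit l')) : UcpDeriv φ l

/-- The set of literals derived by unit clause propagation on `φ`. -/
def UcpSet {n : ℕ} (φ : CnfFormula n) : Set (Lit n) := {l | UcpDeriv φ l}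

/-- UCP on `φ` reaches the contradiction `⊥`: for some clause `C ∈ φ`, the negation of
every literal of `C` is derived. -/
def UcpBot {n : ℕ} (φ : CnfFormula n) : Prop :=
  ∃ C ∈ φ, ∀ l ∈ C, UcpDeriv φ (negLit l)

/-- Formulas `φ₁` and `φ₂` are ucp-equivalent: for every partial assignment `α`,
`UCP(φ₁ ∪ α) = UCP(φ₂ ∪ α)` (either both are `{⊥}`, or neither is and the derived
sets of literals coincide). -/
def UcpEquiv {n : ℕ} (φ₁ φ₂ : CnfFormula n) : Prop :=
  ∀ α : Finset (Lit n), IsPartialAssignment α →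
    (UcpBot (φ₁ ∪ unitClauses α) ↔ UcpBot (φ₂ ∪ unitClauses α)) ∧
    (¬ UcpBot (φ₁ ∪ unitClauses α) →
      UcpSet (φ₁ ∪ unitClauses α) = UcpSet (φ₂ ∪ unitClauses α))

/-- A total assignment satisfies a literal. -/
def SatLit {n : ℕ} (a : Fin n → Bool) (l : Lit n) : Prop := a l.1 = l.2

/-- A total assignment satisfies a clause if it satisfies some literal of it. -/
def SatClause {n : ℕ} (a : Fin n → Bool) (C : Clause n) : Prop := ∃ l ∈ C, SatLit a l

/-- A total assignment satisfies a formula if it satisfies every clause of it. -/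
def SatFormula {n : ℕ} (a : Fin n → Bool) (φ : CnfFormula n) : Prop :=
  ∀ C ∈ φ, SatClause a C


/-- The length `‖φ‖` of a formula: the sum of the numbers of literals of its clauses. -/
def formulaLen {n : ℕ} (φ : CnfFormula n) : ℕ := ∑ C ∈ φ, C.card

/-- The set of negations of the literals in `S`. -/
def negLits {n : ℕ} (S : Finset (Lit n)) : Finset (Lit n) := S.image negLit

/-- A clause `C` is absorbed by a formula `φ`: for every literal `l ∈ C`,
`UCP(φ ∪ neg'(C \ {l}))` contains `l` or equals `{⊥}`. -/
def Absorbed {n : ℕ} (φ : CnfFormula n) (C : Clause n) : Prop :=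
  ∀ l ∈ C,
    UcpDeriv (φ ∪ unitClauses (negLits (C.erase l))) l ∨
    UcpBot (φ ∪ unitClauses (negLits (C.erase l)))

/-- A formula is ucp-irredundant if no clause `C ∈ φ` is absorbed by `φ \ {C}`. -/
def UcpIrredundant {n : ℕ} (φ : CnfFormula n) : Prop :=
  ∀ C ∈ φ, ¬ Absorbed (φ.erase C) C

instance {n : ℕ} (C : Clause n) : Decidable (Clause.Wf C) :=
  decidable_of_iff (∀ l ∈ C, ∀ l' ∈ C, l.1 = l'.1 → l = l') Iff.rfl

/-- `Ψ_{n,k}`: the CNF formula on `x₁, …, xₙ` consisting of all clauses (on pairwise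
distinct variables) containing exactly `k` negative literals and one positive literal. -/
def Psi (n k : ℕ) : CnfFormula n :=
  Finset.univ.filter (fun C : Clause n =>
    Clause.Wf C ∧ (C.filter (fun l => l.2 = false)).card = k ∧
      (C.filter (fun l => l.2 = true)).card = 1)

/-- `neg(A)`: the set of negative literals on the variables in `A`. -/
def negVars {n : ℕ} (A : Finset (Fin n)) : Finset (Lit n) := A.image (fun x => (x, false))

/-- The set of positive literals on the variables in `A`. -/
def posVars {n : ℕ} (A : Finset (Fin n)) : Finset (Lit n) := A.image (fun x => (x, true))

/-- The directed graph `G^d(φ, A)` on `X ∖ A`: directed edge `(x_i, x_j)` whenever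
`neg(A) ∪ {¬x_i, x_j} ∈ φ`. -/
def GdEdge {n : ℕ} (φ : CnfFormula n) (A : Finset (Fin n)) (i j : Fin n) : Prop :=
  insert ((i, false) : Lit n) (insert ((j, true) : Lit n) (negVars A)) ∈ φ

/-- The hypergraph formula `θ(H)`: the clauses `neg(e ∖ {x}) ∪ {x}` for all hyperedges
`e ∈ H` and all variables `x ∈ e`. -/
def theta {n : ℕ} (H : Finset (Finset (Fin n))) : CnfFormula n :=
  H.biUnion (fun e => e.image (fun x => insert ((x, true) : Lit n) (negVars (e.erase x))))

/-- The edge relation of the graph `G(H, A)` on the vertex set `X ∖ A`: its edges are the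
`2`-element sets `e ∖ A` for hyperedges `e ∈ H` with `A ⊆ e`. -/
def GEdge {n : ℕ} (H : Finset (Finset (Fin n))) (A : Finset (Fin n)) (u v : Fin n) : Prop :=
  u ≠ v ∧ ∃ e ∈ H, A ⊆ e ∧ e \ A = {u, v}

/-- A `(k+1)`-uniform hypergraph `H` has connected restrictions if for every
`(k−1)`-element set `A ⊆ X`, the graph `G(H, A)` is connected on the vertex set `X ∖ A`. -/
def ConnectedRestrictions {n : ℕ} (k : ℕ) (H : Finset (Finset (Fin n))) : Prop :=
  ∀ A : Finset (Fin n), A.card + 1 = k →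
    ∀ u ∉ A, ∀ v ∉ A, Relation.ReflTransGen (GEdge H A) u v

@[simp]
lemma negLit_negLit {n : ℕ} (l : Lit n) : negLit (negLit l) = l := by
  simp [negLit]

lemma mem_negLits {n : ℕ} {S : Finset (Lit n)} {l : Lit n} : l ∈ negLits S ↔ negLit l ∈ S := by
  constructor
  · intro h
    obtain ⟨m, hm, rfl⟩ := Finset.mem_image.1 h
    simpa using hm
  · intro h
    exact Finset.mem_image.2 ⟨_, h, negLit_negLit l⟩

/-- Unit propagation on `ψ` derives nothing beyond `φ` if the literals derived from `φ` are
closed under the propagation rule for the clauses of `ψ`. -/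
lemma UcpDeriv.of_closed {n : ℕ} {φ ψ : CnfFormula n}
    (h : ∀ C ∈ ψ, ∀ l ∈ C, (∀ l' ∈ C.erase l, UcpDeriv φ (negLit l')) → UcpDeriv φ l)
    {l : Lit n} (hl : UcpDeriv ψ l) : UcpDeriv φ l := by
  induction hl with
  | step C hC l hl _ ih => exact h C hC l hl ih

lemma UcpDeriv.mono {n : ℕ} {φ ψ : CnfFormula n} (h : φ ⊆ ψ) {l : Lit n}
    (hl : UcpDeriv φ l) : UcpDeriv ψ l :=
  hl.of_closed fun C hC l hl hr => .step C (h hC) l hl hr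

/-- Deriving a complementary pair of literals yields a contradiction. -/
lemma ucpBot_of_complementary {n : ℕ} {φ : CnfFormula n} {l : Lit n}
    (h : UcpDeriv φ l) (h' : UcpDeriv φ (negLit l)) : UcpBot φ := by
  cases h with
  | step C hC _ hl hr =>
    refine ⟨C, hC, fun m hm => ?_⟩
    by_cases hml : m = l
    · exact hml ▸ h'
    · exact hr m (Finset.mem_erase.2 ⟨hml, hm⟩)

/-- A formula is ucp-equivalent to any larger formula without the empty clause whose clauses
propagate nothing new, under any assignment. -/
lemma ucpEquiv_of_subset {n : ℕ} {φ ψ : CnfFormula n} (hsub : φ ⊆ ψ)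
    (hne : ∀ C ∈ ψ, C.Nonempty)
    (h : ∀ χ, φ ⊆ χ → ∀ C ∈ ψ, ∀ l ∈ C,
      (∀ l' ∈ C.erase l, UcpDeriv χ (negLit l')) → UcpDeriv χ l) :
    UcpEquiv φ ψ := by
  intro α _
  have hsub' : φ ∪ unitClauses α ⊆ ψ ∪ unitClauses α := Finset.union_subset_union_left hsub
  have hcl : ∀ C ∈ ψ ∪ unitClauses α, ∀ l ∈ C,
      (∀ l' ∈ C.erase l, UcpDeriv (φ ∪ unitClauses α) (negLit l')) →
        UcpDeriv (φ ∪ unitClauses α) l := by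
    intro C hC l hl hr
    rcases Finset.mem_union.1 hC with hC | hC
    · exact h _ Finset.subset_union_left C hC l hl hr
    · exact .step C (Finset.mem_union_right _ hC) l hl hr
  refine ⟨⟨?_, ?_⟩, fun _ => Set.ext fun l => ⟨UcpDeriv.mono hsub', UcpDeriv.of_closed hcl⟩⟩
  · rintro ⟨C, hC, hr⟩
    exact ⟨C, hsub' hC, fun l hl => (hr l hl).mono hsub'⟩
  · rintro ⟨C, hC, hr⟩
    have hr' := fun l hl => (hr l hl).of_closed hcl
    obtain ⟨l, hl⟩ : C.Nonempty := by
      rcases Finset.mem_union.1 hC with hC | hC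
      · exact hne C hC
      · obtain ⟨a, _, rfl⟩ := Finset.mem_image.1 hC
        exact Finset.singleton_nonempty a
    exact ucpBot_of_complementary
      (hcl C hC l hl fun m hm => hr' m (Finset.mem_of_mem_erase hm)) (hr' l hl)

/-- If no clause of `φ` has all but one of its literals in `S`, where `S` has no complementary
pair, then unit propagation on `φ` together with the negations of `S` derives only these
negations and no contradiction. -/
lemma ucp_union_negLits_inert {n : ℕ} {φ : CnfFormula n} {S : Finset (Lit n)}
    (hS : ∀ l ∈ S, negLit l ∉ S) (hne : ∀ D ∈ φ, D.Nonempty)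
    (hφ : ∀ D ∈ φ, ∀ l ∈ D, ¬ D.erase l ⊆ S) :
    (∀ l, UcpDeriv (φ ∪ unitClauses (negLits S)) l → negLit l ∈ S) ∧
      ¬ UcpBot (φ ∪ unitClauses (negLits S)) := by
  have hder : ∀ l, UcpDeriv (φ ∪ unitClauses (negLits S)) l → negLit l ∈ S := by
    intro l hl
    induction hl with
    | step D hD l hl _ ih =>
      rcases Finset.mem_union.1 hD with hD | hD
      · exact absurd (fun m hm => by simpa using ih m hm) (hφ D hD l hl)
      · obtain ⟨a, ha, rfl⟩ := Finset.mem_image.1 hD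
        rw [Finset.mem_singleton.1 hl]
        exact mem_negLits.1 ha
  refine ⟨hder, ?_⟩
  rintro ⟨D, hD, hr⟩
  have hDS : D ⊆ S := fun m hm => by simpa using hder _ (hr m hm)
  rcases Finset.mem_union.1 hD with hD | hD
  · obtain ⟨l, hl⟩ := hne D hD
    exact hφ D hD l hl ((Finset.erase_subset _ _).trans hDS)
  · obtain ⟨a, ha, rfl⟩ := Finset.mem_image.1 hD
    exact hS a (hDS (Finset.mem_singleton_self a)) (mem_negLits.1 ha)

/-- The definite Horn clause with body `B` and head `x`. -/
def hornClause {n : ℕ} (B : Finset (Fin n)) (x : Fin n) : Clause n :=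
  insert (x, true) (negVars B)

lemma mem_hornClause {n : ℕ} {B : Finset (Fin n)} {x : Fin n} {l : Lit n} :
    l ∈ hornClause B x ↔ l = (x, true) ∨ l.2 = false ∧ l.1 ∈ B := by
  obtain ⟨y, b⟩ := l
  simp only [hornClause, negVars, Finset.mem_insert, Finset.mem_image, Prod.mk.injEq]
  grind

lemma card_negVars {n : ℕ} (B : Finset (Fin n)) : (negVars B).card = B.card :=
  Finset.card_image_of_injective _ fun _ _ h => (Prod.mk.inj h).1

lemma card_hornClause {n : ℕ} (B : Finset (Fin n)) (x : Fin n) :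
    (hornClause B x).card = B.card + 1 := by
  rw [hornClause, Finset.card_insert_of_notMem (by simp [negVars]), card_negVars]

lemma hornClause_nonempty {n : ℕ} (B : Finset (Fin n)) (x : Fin n) :
    (hornClause B x).Nonempty :=
  Finset.insert_nonempty _ _

lemma mem_Psi {n k : ℕ} {C : Clause n} :
    C ∈ Psi n k ↔ ∃ B x, B.card = k ∧ x ∉ B ∧ C = hornClause B x := by
  simp only [Psi, Finset.mem_filter, Finset.mem_univ, true_and]
  constructor
  · rintro ⟨hwf, hneg, hpos⟩
    obtain ⟨p, hp⟩ := Finset.card_eq_one.1 hpos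
    have hmem : ∀ l, l ∈ C ∧ l.2 = true ↔ l = p := fun l => by
      rw [← Finset.mem_singleton (a := p), ← hp, Finset.mem_filter]
    obtain ⟨hpC, hpt⟩ := (hmem p).2 rfl
    refine ⟨(C.filter (fun l => l.2 = false)).image Prod.fst, p.1, ?_, ?_, ?_⟩
    · rw [Finset.card_image_of_injOn, hneg]
      intro a ha b hb hab
      exact hwf a (Finset.mem_filter.1 ha).1 b (Finset.mem_filter.1 hb).1 hab
    · intro h
      obtain ⟨l, hl, hlp⟩ := Finset.mem_image.1 h
      obtain ⟨hlC, hlf⟩ := Finset.mem_filter.1 hl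
      rw [hwf l hlC p hpC hlp, hpt] at hlf
      exact Bool.noConfusion hlf
    · ext ⟨y, b⟩
      rw [mem_hornClause]
      have hp' : (p.1, true) = p := Prod.ext rfl hpt.symm
      rw [hp', ← hmem]
      simp only [Finset.mem_image, Finset.mem_filter, Prod.exists]
      cases b <;> simp
  · rintro ⟨B, x, hB, hx, rfl⟩
    refine ⟨?_, ?_, ?_⟩
    · intro l hl m hm hlm
      rw [mem_hornClause] at hl hm
      grind
    · rw [← hB, ← card_negVars]
      congr 1
      ext ⟨y, b⟩
      simp only [Finset.mem_filter, mem_hornClause, negVars, Finset.mem_image]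
      grind
    · rw [Finset.card_eq_one]
      refine ⟨(x, true), ?_⟩
      ext ⟨y, b⟩
      simp only [Finset.mem_filter, mem_hornClause, Finset.mem_singleton]
      grind

/-- The hypergraph of all `(k+1)`-element sets of variables containing `x₁`. -/
def starHypergraph {n : ℕ} (k : ℕ) (x₁ : Fin n) : Finset (Finset (Fin n)) :=
  Finset.univ.filter (fun e : Finset (Fin n) => e.card = k + 1 ∧ x₁ ∈ e)

lemma mem_theta_starHypergraph {n k : ℕ} {x₁ : Fin n} {C : Clause n} :
    C ∈ theta (starHypergraph k x₁) ↔
      ∃ B x, B.card = k ∧ x ∉ B ∧ x₁ ∈ insert x B ∧ C = hornClause B x := by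
  simp only [theta, starHypergraph, Finset.mem_biUnion, Finset.mem_filter, Finset.mem_univ,
    true_and, Finset.mem_image]
  constructor
  · rintro ⟨e, ⟨hcard, hmem⟩, x, hx, rfl⟩
    refine ⟨e.erase x, x, ?_, Finset.notMem_erase x e, ?_, rfl⟩
    · rw [Finset.card_erase_of_mem hx, hcard, Nat.add_sub_cancel]
    · rwa [Finset.insert_erase hx]
  · rintro ⟨B, x, hB, hx, hx₁, rfl⟩
    refine ⟨insert x B, ⟨?_, hx₁⟩, x, Finset.mem_insert_self x B, ?_⟩
    · rw [Finset.card_insert_of_notMem hx, hB]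
    · rw [Finset.erase_insert hx, hornClause]

lemma theta_starHypergraph_subset_Psi {n k : ℕ} (x₁ : Fin n) :
    theta (starHypergraph k x₁) ⊆ Psi n k := by
  intro C hC
  obtain ⟨B, x, hB, hx, _, rfl⟩ := mem_theta_starHypergraph.1 hC
  exact mem_Psi.2 ⟨B, x, hB, hx, rfl⟩

lemma ucpIrredundant_theta_starHypergraph {n k : ℕ} (x₁ : Fin n) :
    UcpIrredundant (theta (starHypergraph k x₁)) := by
  intro C hC habs
  obtain ⟨B, x, hB, hx, hx₁, rfl⟩ := mem_theta_starHypergraph.1 hC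
  -- the literal of the clause on the variable `x₁` is the one that is not propagated
  obtain ⟨b, hb⟩ : ∃ b, (x₁, b) ∈ hornClause B x := by
    rcases Finset.mem_insert.1 hx₁ with rfl | h
    · exact ⟨true, mem_hornClause.2 (.inl rfl)⟩
    · exact ⟨false, mem_hornClause.2 (.inr ⟨rfl, h⟩)⟩
  have hinert := ucp_union_negLits_inert (φ := (theta (starHypergraph k x₁)).erase
      (hornClause B x)) (S := (hornClause B x).erase (x₁, b)) ?_ ?_ ?_
  · rcases habs _ hb with h | h
    · have := hinert.1 _ h
      simp only [Finset.mem_erase, mem_hornClause] at this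
      rw [mem_hornClause] at hb
      simp only [negLit] at this
      grind
    · exact hinert.2 h
  · intro l hl hl'
    simp only [Finset.mem_erase, mem_hornClause, negLit] at hl hl'
    grind
  · intro D hD
    obtain ⟨B', x', _, _, _, rfl⟩ := mem_theta_starHypergraph.1 (Finset.mem_of_mem_erase hD)
    exact hornClause_nonempty B' x'
  · intro D hD l hl hsub
    obtain ⟨hDne, hD⟩ := Finset.mem_erase.1 hD
    obtain ⟨B', x', hB', hx', hx₁', rfl⟩ := mem_theta_starHypergraph.1 hD
    have heq : (hornClause B' x').erase l = (hornClause B x).erase (x₁, b) := by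
      refine Finset.eq_of_subset_of_card_le hsub ?_
      rw [Finset.card_erase_of_mem hl, Finset.card_erase_of_mem hb, card_hornClause,
        card_hornClause, hB, hB']
    have hmem : ∀ m, (m ≠ l ∧ m ∈ hornClause B' x') ↔ (m ≠ (x₁, b) ∧ m ∈ hornClause B x) :=
      fun m => by rw [← Finset.mem_erase, ← Finset.mem_erase, heq]
    have hl₁ : l = (x₁, b) := by
      simp only [mem_hornClause] at hmem hl hb
      have h₁ := hmem (x₁, true)
      have h₂ := hmem (x₁, false)
      have h₃ := hmem (x, true)
      have h₄ := hmem (x', true)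
      obtain ⟨y, c⟩ := l
      cases b <;> cases c <;> grind
    apply hDne
    rw [← Finset.insert_erase hl, heq, hl₁, Finset.insert_erase hb]

lemma ucpDeriv_head {n : ℕ} {χ : CnfFormula n} {B : Finset (Fin n)} {x : Fin n}
    (hC : hornClause B x ∈ χ) (h : ∀ y ∈ B, UcpDeriv χ (y, true)) : UcpDeriv χ (x, true) := by
  refine .step _ hC _ (mem_hornClause.2 (.inl rfl)) ?_
  rintro ⟨y, b⟩ hl
  obtain ⟨hne, hl⟩ := Finset.mem_erase.1 hl
  obtain ⟨rfl, hy⟩ := (mem_hornClause.1 hl).resolve_left hne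
  exact h y hy

lemma ucpDeriv_body {n : ℕ} {χ : CnfFormula n} {B : Finset (Fin n)} {x z : Fin n}
    (hC : hornClause B x ∈ χ) (hz : z ∈ B) (hx : UcpDeriv χ (x, false))
    (h : ∀ y ∈ B, y ≠ z → UcpDeriv χ (y, true)) : UcpDeriv χ (z, false) := by
  refine .step _ hC _ (mem_hornClause.2 (.inr ⟨rfl, hz⟩)) ?_
  rintro ⟨y, b⟩ hl
  obtain ⟨hne, hl⟩ := Finset.mem_erase.1 hl
  rcases mem_hornClause.1 hl with hl | ⟨rfl, hy⟩
  · rw [hl]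
    exact hx
  · exact h y hy fun hyz => hne (by rw [hyz])

lemma ucpEquiv_theta_starHypergraph_Psi {n k : ℕ} (hk : 1 ≤ k) (x₁ : Fin n) :
    UcpEquiv (theta (starHypergraph k x₁)) (Psi n k) := by
  refine ucpEquiv_of_subset (theta_starHypergraph_subset_Psi x₁) ?_ ?_
  · intro C hC
    obtain ⟨B, x, _, _, rfl⟩ := mem_Psi.1 hC
    exact hornClause_nonempty B x
  intro χ hχ C hC l hl hr
  obtain ⟨B, x, hB, hx, rfl⟩ := mem_Psi.1 hC
  by_cases hx₁ : x₁ ∈ insert x B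
  · exact .step _ (hχ (mem_theta_starHypergraph.2 ⟨B, x, hB, hx, hx₁, rfl⟩)) l hl hr
  obtain ⟨hne, hx₁B⟩ : x₁ ≠ x ∧ x₁ ∉ B := by simpa using hx₁
  have hto : hornClause B x₁ ∈ χ :=
    hχ (mem_theta_starHypergraph.2 ⟨B, x₁, hB, hx₁B, Finset.mem_insert_self _ _, rfl⟩)
  have hfrom : ∀ z ∈ B, hornClause (insert x₁ (B.erase z)) x ∈ χ := by
    intro z hz
    refine hχ (mem_theta_starHypergraph.2 ⟨_, x, ?_, ?_, by simp, rfl⟩)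
    · rw [Finset.card_insert_of_notMem (by simp [hx₁B]), Finset.card_erase_add_one hz, hB]
    · simp [hne.symm, hx]
  have hbody : ∀ y ∈ B, (y, false) ≠ l → UcpDeriv χ (y, true) := fun y hy hyl =>
    hr (y, false) (Finset.mem_erase.2 ⟨hyl, mem_hornClause.2 (.inr ⟨rfl, hy⟩)⟩)
  obtain ⟨z, b⟩ := l
  rcases mem_hornClause.1 hl with hl | ⟨hb, hz⟩
  · rw [hl] at hbody ⊢
    have hpos : ∀ y ∈ B, UcpDeriv χ (y, true) := fun y hy => hbody y hy (by simp)
    obtain ⟨w, hw⟩ : B.Nonempty := Finset.card_pos.1 (by omega)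
    refine ucpDeriv_head (hfrom w hw) fun y hy => ?_
    rcases Finset.mem_insert.1 hy with rfl | hy
    · exact ucpDeriv_head hto hpos
    · exact hpos y (Finset.mem_of_mem_erase hy)
  · obtain rfl : b = false := hb
    have hpos : ∀ y ∈ B, y ≠ z → UcpDeriv χ (y, true) := fun y hy hyz =>
      hbody y hy (by simpa using hyz)
    have hhead : UcpDeriv χ (x, false) :=
      hr (x, true) (Finset.mem_erase.2 ⟨by simp, mem_hornClause.2 (.inl rfl)⟩)
    refine ucpDeriv_body hto hz ?_ hpos
    refine ucpDeriv_body (hfrom z hz) (Finset.mem_insert_self _ _) hhead fun y hy hyne => ?_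
    have hy' := Finset.mem_of_mem_insert_of_ne hy hyne
    exact hpos y (Finset.mem_of_mem_erase hy') (Finset.ne_of_mem_erase hy')

/-- Let `1 ≤ k ≤ n−1`, let `H₁` be the `(k+1)`-uniform hypergraph consisting
of all `(k+1)`-element subsets of `X` containing the variable `x₁`, and let `φℓ = θ(H₁)`.
Then `φℓ` is ucp-irredundant and ucp-equivalent to `Ψ_{n,k}`. -/
theorem phiEll_ucpIrredundant_and_ucpEquiv_psi {n k : ℕ} (hk : 1 ≤ k) (hkn : k + 1 ≤ n)
    (x₁ : Fin n) :
    UcpIrredundant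
        (theta (Finset.univ.filter (fun e : Finset (Fin n) => e.card = k + 1 ∧ x₁ ∈ e))) ∧
    UcpEquiv
        (theta (Finset.univ.filter (fun e : Finset (Fin n) => e.card = k + 1 ∧ x₁ ∈ e)))
        (Psi n k) := by
  exact ⟨ucpIrredundant_theta_starHypergraph x₁, ucpEquiv_theta_starHypergraph_Psi hk x₁⟩
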